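/- Let α_i, β_i (i ∈ ℕ), α, β be p.m.p. actions of a countably infinite group Γ such that for every finite S' ⊆ Γ and every k' ∈ ℕ⁺, dist_H(C(α_i,S',k'), C(α,S',k')) → 0 and dist_H(C(β_i,S',k'), C(β,S',k')) → 0 as i → ∞. Suppose moreover that for every finite S ⊆ Γ, k ∈ ℕ⁺, and ε > 0 there is N ∈ ℕ⁺ with N_{S,k}(α_i,β_i,ε) ≤ N for all i ∈ ℕ. Then for every finite S ⊆ Γ and every k ∈ ℕ⁺, dist_H(C(α_i×β_i,S,k), C(α×β,S,k)) → 0 as i → ∞. -/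

import Mathlib

open MeasureTheory Filter Topology

/-- A probability-measure-preserving (p.m.p.) action of a group `Γ`,
bundled together with the probability space it acts on. -/
structure PMP (Γ : Type) [Group Γ] where
  /-- the underlying space -/
  X : Type
  /-- the σ-algebra -/
  [mX : MeasurableSpace X]
  /-- the measure -/
  μ : @Measure X mX
  /-- the measure is a probability measure -/
  [prob : IsProbabilityMeasure μ]
  /-- the action map -/
  act : Γ → X → X
  one_act : ∀ x, act 1 x = x
  mul_act : ∀ γ δ x, act (γ * δ) x = act γ (act δ x)
  /-- each group element acts by a measure-preserving (in particular measurable) map -/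
  preserves : ∀ γ, MeasurePreserving (act γ) μ μ

attribute [instance] PMP.mX PMP.prob

variable {Γ : Type} [Group Γ]

/-- A p.m.p. action is free if almost every point has trivial stabilizer. -/
def PMP.Free (a : PMP Γ) : Prop :=
  a.μ {x | ∀ γ : Γ, γ ≠ 1 → a.act γ x ≠ x} = 1

/-- The vector `M^α_{S,k}[f] ∈ [0,1]^{S×k×k}`, defined by
`M^α_{S,k}[f](γ,i,j) = μ {x | f x = i ∧ f (γ • x) = j}`. -/
noncomputable def PMP.M (a : PMP Γ) (S : Finset Γ) (k : ℕ) (f : a.X → Fin k) :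
    ↥S × Fin k × Fin k → ℝ :=
  fun q => (a.μ {x | f x = q.2.1 ∧ f (a.act (q.1 : Γ) x) = q.2.2}).toReal

/-- `C(α,S,k)`: the closure of the set of vectors `M^α_{S,k}[f]`, where `f` ranges over
measurable maps `X → k`, taken in `[0,1]^{S×k×k}`.  (The space `↥S × Fin k × Fin k → ℝ`
carries the sup metric `dist_∞`, since the product distance on a finite product of copies
of `ℝ` is the max of the coordinate distances.) -/
noncomputable def PMP.C (a : PMP Γ) (S : Finset Γ) (k : ℕ) :
    Set (↥S × Fin k × Fin k → ℝ) :=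
  closure {v | ∃ f : a.X → Fin k, Measurable f ∧ a.M S k f = v}

/-- The product of two p.m.p. actions:  `γ • (x, y) = (γ • x, γ • y)` on `(X × Y, μ × ν)`. -/
noncomputable def PMP.prod (a b : PMP Γ) : PMP Γ where
  X := a.X × b.X
  μ := a.μ.prod b.μ
  act γ p := (a.act γ p.1, b.act γ p.2)
  one_act := by intro p; simp [a.one_act, b.one_act]
  mul_act := by intro γ δ p; simp [a.mul_act, b.mul_act]
  preserves γ := (a.preserves γ).prod (b.preserves γ)

/-- `f ∈ Step_{k,N}(X,μ;Y,ν)`: `f = φ ∘ (g,h)` for measurable `g : X → N`, `h : Y → N`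
and some `φ : N × N → k`. -/
def IsStep {Γ : Type} [Group Γ] (a b : PMP Γ) (k N : ℕ)
    (f : (a.prod b).X → Fin k) : Prop :=
  ∃ (g : a.X → Fin N) (h : b.X → Fin N) (φ : Fin N × Fin N → Fin k),
    Measurable g ∧ Measurable h ∧ ∀ p : a.X × b.X, f p = φ (g p.1, h p.2)

/-- The set `{M^{α×β}_{S,k}[f] : f ∈ Step_{k,N}}` is an ε-net in `C(α×β,S,k)`:
every point of `C(α×β,S,k)` is at `dist_∞`-distance `< ε` from a point of this set. -/
def StepNet {Γ : Type} [Group Γ] (a b : PMP Γ) (S : Finset Γ) (k N : ℕ) (ε : ℝ) : Prop :=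
  ∀ v ∈ (a.prod b).C S k, ∃ f : (a.prod b).X → Fin k,
    IsStep a b k N f ∧ dist v ((a.prod b).M S k f) < ε

/-- `N_{S,k}(α,β,ε)`: the least `N ∈ ℕ⁺` such that `{M^{α×β}_{S,k}[f] : f ∈ Step_{k,N}}`
is an ε-net in `C(α×β,S,k)`. -/
noncomputable def NStep {Γ : Type} [Group Γ] (a b : PMP Γ) (S : Finset Γ) (k : ℕ)
    (ε : ℝ) : ℕ :=
  sInf {N : ℕ | 0 < N ∧ StepNet a b S k N ε}

open scoped symmDiff

/-- The sets in a product of measurable spaces that are finite unions of measurable rectangles,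
presented through a pair of measurable maps to a finite set. -/
def stepSets (X Y : Type*) [MeasurableSpace X] [MeasurableSpace Y] : Set (Set (X × Y)) :=
  {s | ∃ (N : ℕ) (g : X → Fin N) (h : Y → Fin N) (T : Set (Fin N × Fin N)),
    Measurable g ∧ Measurable h ∧ s = (fun p : X × Y => (g p.1, h p.2)) ⁻¹' T}

/-- A function factoring through two maps to arbitrary finite types also factors through two maps
to a common `Fin N`. -/
lemma exists_fin_factor {X Y ι κ E : Type*} [MeasurableSpace X] [MeasurableSpace Y]
    [Finite ι] [Finite κ] [MeasurableSpace ι] [MeasurableSpace κ]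
    [DiscreteMeasurableSpace ι] [DiscreteMeasurableSpace κ] [Nonempty E]
    {g : X → ι} {h : Y → κ} (hg : Measurable g) (hh : Measurable h) (φ : ι × κ → E) :
    ∃ (N : ℕ) (g' : X → Fin N) (h' : Y → Fin N) (φ' : Fin N × Fin N → E),
      Measurable g' ∧ Measurable h' ∧ ∀ x y, φ' (g' x, h' y) = φ (g x, h y) := by
  obtain ⟨N, ⟨e⟩⟩ := Finite.exists_equiv_fin (ι ⊕ κ)
  let u : ι × κ → Fin N × Fin N := Prod.map (e ∘ Sum.inl) (e ∘ Sum.inr)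
  have hu : Function.Injective u :=
    (e.injective.comp Sum.inl_injective).prodMap (e.injective.comp Sum.inr_injective)
  refine ⟨N, fun x => e (Sum.inl (g x)), fun y => e (Sum.inr (h y)),
    Function.extend u φ fun _ => Classical.arbitrary E,
    (Measurable.of_discrete (f := fun i => e (Sum.inl i))).comp hg,
    (Measurable.of_discrete (f := fun i => e (Sum.inr i))).comp hh, fun x y => ?_⟩
  exact hu.extend_apply φ _ (g x, h y)

lemma exists_common_factor {X Y ι : Type*} [MeasurableSpace X] [MeasurableSpace Y] [Finite ι]
    {t : ι → Set (X × Y)} (ht : ∀ i, t i ∈ stepSets X Y) :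
    ∃ (N : ℕ) (g : X → Fin N) (h : Y → Fin N) (T : ι → Set (Fin N × Fin N)),
      Measurable g ∧ Measurable h ∧ ∀ i, t i = (fun p : X × Y => (g p.1, h p.2)) ⁻¹' T i := by
  choose n g h T hg hh hT using ht
  obtain ⟨N, g', h', T', hg', hh', hT'⟩ := exists_fin_factor
    (g := fun x i => g i x) (h := fun y i => h i y) (measurable_pi_lambda _ hg)
    (measurable_pi_lambda _ hh) (fun p i => (p.1 i, p.2 i) ∈ T i)
  refine ⟨N, g', h', fun i => {q | T' q i}, hg', hh', fun i => ?_⟩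
  ext ⟨x, y⟩
  rw [hT i]
  simp [hT']

lemma isSetAlgebra_stepSets (X Y : Type*) [MeasurableSpace X] [MeasurableSpace Y] :
    IsSetAlgebra (stepSets X Y) where
  empty_mem := ⟨1, fun _ => 0, fun _ => 0, ∅, measurable_const, measurable_const, by simp⟩
  compl_mem := by
    rintro s ⟨N, g, h, T, hg, hh, rfl⟩
    exact ⟨N, g, h, Tᶜ, hg, hh, rfl⟩
  union_mem := by
    intro s t hs ht
    obtain ⟨N, g, h, T, hg, hh, hT⟩ := exists_common_factor (t := fun b : Bool => bif b then s else t)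
      (by rintro (_ | _) <;> assumption)
    refine ⟨N, g, h, T true ∪ T false, hg, hh, ?_⟩
    rw [Set.preimage_union, ← hT, ← hT]
    rfl

lemma prod_mem_stepSets {X Y : Type*} [MeasurableSpace X] [MeasurableSpace Y] {s : Set X}
    {t : Set Y} (hs : MeasurableSet s) (ht : MeasurableSet t) : s ×ˢ t ∈ stepSets X Y := by
  obtain ⟨N, g, h, T, hg, hh, hT⟩ := exists_fin_factor (X := X) (Y := Y)
    (g := fun x => x ∈ s) (h := fun y => y ∈ t) (E := Prop)
    (measurable_mem.2 hs) (measurable_mem.2 ht) (fun p => p.1 ∧ p.2)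
  refine ⟨N, g, h, {q | T q}, hg, hh, ?_⟩
  ext ⟨x, y⟩
  simp [hT]

lemma measurableSet_of_mem_stepSets {X Y : Type*} [MeasurableSpace X] [MeasurableSpace Y]
    {s : Set (X × Y)} (hs : s ∈ stepSets X Y) : MeasurableSet s := by
  obtain ⟨N, g, h, T, hg, hh, rfl⟩ := hs
  exact (by fun_prop : Measurable fun p : X × Y => (g p.1, h p.2)) (Set.toFinite T).measurableSet

lemma generateFrom_stepSets (X Y : Type*) [MeasurableSpace X] [MeasurableSpace Y] :
    (inferInstance : MeasurableSpace (X × Y)) = MeasurableSpace.generateFrom (stepSets X Y) := by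
  refine le_antisymm ?_ (MeasurableSpace.generateFrom_le fun s => measurableSet_of_mem_stepSets)
  rw [← generateFrom_prod]
  refine MeasurableSpace.generateFrom_mono ?_
  rintro _ ⟨s, hs, t, ht, rfl⟩
  exact prod_mem_stepSets hs ht

/-- Measurable finite-valued functions on a product are approximated in measure by functions
factoring through finite-valued functions on the factors. -/
lemma exists_step_approx {X Y : Type*} [MeasurableSpace X] [MeasurableSpace Y]
    (μ : Measure (X × Y)) [IsFiniteMeasure μ] {k : ℕ} (hk : 0 < k) {f : X × Y → Fin k}
    (hf : Measurable f) {ε : ℝ} (hε : 0 < ε) :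
    ∃ (N : ℕ) (g : X → Fin N) (h : Y → Fin N) (φ : Fin N × Fin N → Fin k),
      Measurable g ∧ Measurable h ∧ μ.real {p | f p ≠ φ (g p.1, h p.2)} < ε := by
  have hk' : (0 : ℝ) < k := by exact_mod_cast hk
  have key (i : Fin k) : ∃ t ∈ stepSets X Y, μ (t ∆ (f ⁻¹' {i})) < ENNReal.ofReal (ε / k) :=
    exists_measure_symmDiff_lt_of_generateFrom_isSetRing
      (isSetAlgebra_stepSets X Y).isSetRing
      ⟨{Set.univ}, Set.countable_singleton _,
        by simpa using (isSetAlgebra_stepSets X Y).univ_mem, by simp⟩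
      (generateFrom_stepSets X Y) (hf (measurableSet_singleton i))
      (ENNReal.ofReal_pos.2 (by positivity))
  choose t ht hμ using key
  obtain ⟨N, g, h, T, hg, hh, hT⟩ := exists_common_factor ht
  classical
  let φ : Fin N × Fin N → Fin k := fun q => if hq : ∃ i, q ∈ T i then hq.choose else ⟨0, hk⟩
  refine ⟨N, g, h, φ, hg, hh, ?_⟩
  have hsub : {p | f p ≠ φ (g p.1, h p.2)} ⊆ ⋃ i, t i ∆ (f ⁻¹' {i}) := by
    intro p hp
    by_contra hcon
    have hiff (i : Fin k) : (g p.1, h p.2) ∈ T i ↔ f p = i := by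
      have h1 : p ∈ t i ↔ (g p.1, h p.2) ∈ T i := by rw [hT i]; rfl
      have h2 : p ∉ t i ∆ (f ⁻¹' {i}) := fun h' => hcon (Set.mem_iUnion.2 ⟨i, h'⟩)
      rw [Set.mem_symmDiff, Set.mem_preimage, Set.mem_singleton_iff] at h2
      tauto
    have hex : ∃ i, (g p.1, h p.2) ∈ T i := ⟨f p, (hiff _).2 rfl⟩
    refine hp ?_
    have hφ : φ (g p.1, h p.2) = hex.choose := dif_pos hex
    rw [hφ]
    exact (hiff _).1 hex.choose_spec
  have : Nonempty (Fin k) := ⟨⟨0, hk⟩⟩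
  calc μ.real {p | f p ≠ φ (g p.1, h p.2)}
      ≤ μ.real (⋃ i, t i ∆ (f ⁻¹' {i})) := measureReal_mono hsub
    _ ≤ ∑ i, μ.real (t i ∆ (f ⁻¹' {i})) := measureReal_iUnion_fintype_le _
    _ < ∑ _i : Fin k, ε / k := by
        refine Finset.sum_lt_sum_of_nonempty Finset.univ_nonempty fun i _ => ?_
        rw [measureReal_def]
        exact ENNReal.toReal_lt_of_lt_ofReal (hμ i)
    _ = ε := by simp; field_simp

namespace PMP

lemma M_mem_Icc (a : PMP Γ) (S : Finset Γ) (k : ℕ) (f : a.X → Fin k)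
    (q : ↥S × Fin k × Fin k) : a.M S k f q ∈ Set.Icc (0 : ℝ) 1 :=
  ⟨ENNReal.toReal_nonneg, measureReal_le_one⟩

lemma M_mem_C (a : PMP Γ) (S : Finset Γ) {k : ℕ} {f : a.X → Fin k} (hf : Measurable f) :
    a.M S k f ∈ a.C S k :=
  subset_closure ⟨f, hf, rfl⟩

lemma C_subset (a : PMP Γ) (S : Finset Γ) (k : ℕ) :
    a.C S k ⊆ Set.pi Set.univ fun _ => Set.Icc (0 : ℝ) 1 := by
  refine closure_minimal ?_ (isClosed_set_pi fun _ _ => isClosed_Icc)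
  rintro _ ⟨f, -, rfl⟩ q -
  exact a.M_mem_Icc S k f q

lemma isCompact_C (a : PMP Γ) (S : Finset Γ) (k : ℕ) : IsCompact (a.C S k) :=
  (isCompact_univ_pi fun _ => isCompact_Icc).of_isClosed_subset isClosed_closure (a.C_subset S k)

lemma C_nonempty (a : PMP Γ) (S : Finset Γ) {k : ℕ} (hk : 0 < k) : (a.C S k).Nonempty :=
  ⟨_, a.M_mem_C S (f := fun _ => ⟨0, hk⟩) measurable_const⟩

lemma hausdorffEDist_C_ne_top (a b : PMP Γ) (S : Finset Γ) {k : ℕ} (hk : 0 < k) :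
    Metric.hausdorffEDist (a.C S k) (b.C S k) ≠ ⊤ :=
  Metric.hausdorffEDist_ne_top_of_nonempty_of_bounded (a.C_nonempty S hk) (b.C_nonempty S hk)
    (a.isCompact_C S k).isBounded (b.isCompact_C S k).isBounded

lemma exists_measurable_dist_lt {a : PMP Γ} {S : Finset Γ} {k : ℕ}
    {v : ↥S × Fin k × Fin k → ℝ} (hv : v ∈ a.C S k) {ε : ℝ} (hε : 0 < ε) :
    ∃ f : a.X → Fin k, Measurable f ∧ dist v (a.M S k f) < ε := by
  obtain ⟨_, ⟨f, hf, rfl⟩, h⟩ := Metric.mem_closure_iff.1 hv ε hε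
  exact ⟨f, hf, h⟩

lemma dist_M_le (a : PMP Γ) (S : Finset Γ) {k : ℕ} {f g : a.X → Fin k}
    (hf : Measurable f) (hg : Measurable g) :
    dist (a.M S k f) (a.M S k g) ≤ 2 * a.μ.real {x | f x ≠ g x} := by
  refine (dist_pi_le_iff (by positivity)).2 fun ⟨γ, i, j⟩ => ?_
  have hact := (a.preserves γ).measurable
  have hD : MeasurableSet {x | f x ≠ g x} := (measurableSet_eq_fun hf hg).compl
  have hms {f : a.X → Fin k} (hf : Measurable f) :
      MeasurableSet {x | f x = i ∧ f (a.act γ x) = j} :=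
    (measurableSet_eq_fun hf measurable_const).inter
      (measurableSet_eq_fun (hf.comp hact) measurable_const)
  have hsub : {x | f x = i ∧ f (a.act γ x) = j} ∆ {x | g x = i ∧ g (a.act γ x) = j} ⊆
      {x | f x ≠ g x} ∪ a.act γ ⁻¹' {x | f x ≠ g x} := by
    intro x hx
    by_contra hcon
    simp only [Set.mem_union, Set.mem_preimage, Set.mem_ofPred_eq, not_or, not_not] at hcon
    simp [Set.mem_symmDiff, hcon.1, hcon.2] at hx
    tauto
  calc dist (a.M S k f (γ, i, j)) (a.M S k g (γ, i, j))
      ≤ a.μ.real ({x | f x = i ∧ f (a.act γ x) = j} ∆ {x | g x = i ∧ g (a.act γ x) = j}) :=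
        abs_measureReal_sub_le_measureReal_symmDiff (hms hf).nullMeasurableSet
          (hms hg).nullMeasurableSet
    _ ≤ a.μ.real ({x | f x ≠ g x} ∪ a.act γ ⁻¹' {x | f x ≠ g x}) := measureReal_mono hsub
    _ ≤ a.μ.real {x | f x ≠ g x} + a.μ.real (a.act γ ⁻¹' {x | f x ≠ g x}) :=
        measureReal_union_le _ _
    _ = 2 * a.μ.real {x | f x ≠ g x} := by
        rw [(a.preserves γ).measureReal_preimage hD.nullMeasurableSet, two_mul]

end PMP

open Classical in
lemma PMP.M_prod_step (a b : PMP Γ) (S : Finset Γ) {k N : ℕ} {g : a.X → Fin N} {h : b.X → Fin N}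
    (hg : Measurable g) (hh : Measurable h) (φ : Fin N × Fin N → Fin k)
    (γ : ↥S) (i j : Fin k) :
    (a.prod b).M S k (fun p : a.X × b.X => φ (g p.1, h p.2)) (γ, i, j) =
      ∑ q : (Fin N × Fin N) × (Fin N × Fin N) with φ q.1 = i ∧ φ q.2 = j,
        a.M S N g (γ, q.1.1, q.2.1) * b.M S N h (γ, q.1.2, q.2.2) := by
  let F : a.X × b.X → (Fin N × Fin N) × (Fin N × Fin N) :=
    fun p => ((g p.1, h p.2), (g (a.act γ p.1), h (b.act γ p.2)))
  have hact := (a.preserves γ).measurable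
  have hbct := (b.preserves γ).measurable
  have hF : Measurable F := by fun_prop
  have hrect (q : (Fin N × Fin N) × (Fin N × Fin N)) :
      (a.μ.prod b.μ).real (F ⁻¹' {q}) =
        a.M S N g (γ, q.1.1, q.2.1) * b.M S N h (γ, q.1.2, q.2.2) := by
    have : F ⁻¹' {q} = {x | g x = q.1.1 ∧ g (a.act γ x) = q.2.1} ×ˢ
        {y | h y = q.1.2 ∧ h (b.act γ y) = q.2.2} := by
      ext p
      simp only [F, Set.mem_preimage, Set.mem_singleton_iff, Prod.ext_iff, Set.mem_prod,
        Set.mem_ofPred_eq]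
      tauto
    rw [this, measureReal_prod_prod]
    rfl
  simp_rw [← hrect]
  rw [sum_measureReal_preimage_singleton _ fun q _ => hF (measurableSet_singleton q)]
  change (a.μ.prod b.μ).real _ = _
  congr 1
  ext p
  simp [F, PMP.prod]

lemma abs_mul_sub_mul_le {x y x' y' δ : ℝ} (hy : y ∈ Set.Icc (0 : ℝ) 1)
    (hx' : x' ∈ Set.Icc (0 : ℝ) 1) (hx : |x - x'| ≤ δ) (hyy : |y - y'| ≤ δ) :
    |x * y - x' * y'| ≤ 2 * δ := by
  have h1 : x * y - x' * y' = (x - x') * y + x' * (y - y') := by ring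
  calc |x * y - x' * y'| ≤ |(x - x') * y| + |x' * (y - y')| := h1 ▸ abs_add_le _ _
    _ = |x - x'| * y + x' * |y - y'| := by
        rw [abs_mul, abs_mul, abs_of_nonneg hy.1, abs_of_nonneg hx'.1]
    _ ≤ δ * 1 + 1 * δ := by
        have hδ := (abs_nonneg _).trans hx
        exact add_le_add (mul_le_mul hx hy.2 hy.1 hδ) (mul_le_mul hx'.2 hyy (abs_nonneg _) one_pos.le)
    _ = 2 * δ := by ring

lemma PMP.dist_M_prod_step_le {a b a' b' : PMP Γ} {S : Finset Γ} {k N : ℕ}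
    {g : a.X → Fin N} {h : b.X → Fin N} {g' : a'.X → Fin N} {h' : b'.X → Fin N}
    (hg : Measurable g) (hh : Measurable h) (hg' : Measurable g') (hh' : Measurable h')
    (φ : Fin N × Fin N → Fin k) {δ : ℝ}
    (hδa : dist (a.M S N g) (a'.M S N g') ≤ δ) (hδb : dist (b.M S N h) (b'.M S N h') ≤ δ) :
    dist ((a.prod b).M S k fun p : a.X × b.X => φ (g p.1, h p.2))
      ((a'.prod b').M S k fun p : a'.X × b'.X => φ (g' p.1, h' p.2)) ≤ N ^ 4 * (2 * δ) := by
  classical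
  have hδ : 0 ≤ δ := dist_nonneg.trans hδa
  refine (dist_pi_le_iff (by positivity)).2 fun ⟨γ, i, j⟩ => ?_
  rw [a.M_prod_step b S hg hh, a'.M_prod_step b' S hg' hh', Real.dist_eq,
    ← Finset.sum_sub_distrib]
  refine (Finset.abs_sum_le_sum_abs _ _).trans ?_
  refine (Finset.sum_le_card_nsmul _ _ (2 * δ) fun q _ => ?_).trans ?_
  · exact abs_mul_sub_mul_le (b.M_mem_Icc ..) (a'.M_mem_Icc ..)
      ((dist_le_pi_dist _ _ _).trans hδa) ((dist_le_pi_dist _ _ _).trans hδb)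
  · rw [nsmul_eq_mul]
    refine mul_le_mul_of_nonneg_right ?_ (by positivity)
    refine (Nat.cast_le.2 (Finset.card_filter_le _ _)).trans ?_
    simp only [Finset.card_univ, Fintype.card_prod, Fintype.card_fin]
    push_cast
    exact le_of_eq (by ring)

lemma IsStep.mono {a b : PMP Γ} {k N N' : ℕ} {f : (a.prod b).X → Fin k} (hf : IsStep a b k N f)
    (hN : N ≤ N') : IsStep a b k N' f := by
  obtain ⟨g, h, φ, hg, hh, hφ⟩ := hf
  have : Nonempty (Fin k) := (nonempty_of_isProbabilityMeasure (a.prod b).μ).map f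
  have hinj := Fin.castLE_injective hN
  refine ⟨fun x => Fin.castLE hN (g x), fun y => Fin.castLE hN (h y),
    Function.extend (Prod.map (Fin.castLE hN) (Fin.castLE hN)) φ fun _ => Classical.arbitrary _,
    (Measurable.of_discrete (f := Fin.castLE hN)).comp hg,
    (Measurable.of_discrete (f := Fin.castLE hN)).comp hh, fun p => ?_⟩
  rw [hφ p]
  exact ((hinj.prodMap hinj).extend_apply φ _ (g p.1, h p.2)).symm

lemma StepNet.mono {a b : PMP Γ} {S : Finset Γ} {k N N' : ℕ} {ε : ℝ}
    (h : StepNet a b S k N ε) (hN : N ≤ N') : StepNet a b S k N' ε := fun v hv =>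
  let ⟨f, hf, hd⟩ := h v hv
  ⟨f, hf.mono hN, hd⟩

lemma exists_isStep_dist_lt {a b : PMP Γ} {S : Finset Γ} {k : ℕ} (hk : 0 < k) {ε : ℝ} (hε : 0 < ε)
    {v : ↥S × Fin k × Fin k → ℝ} (hv : v ∈ (a.prod b).C S k) :
    ∃ (N : ℕ) (f : (a.prod b).X → Fin k), IsStep a b k N f ∧ dist v ((a.prod b).M S k f) < ε := by
  obtain ⟨f, hf, hvf⟩ := PMP.exists_measurable_dist_lt hv (half_pos hε)
  obtain ⟨N, g, h, φ, hg, hh, hμ⟩ :=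
    exists_step_approx (a.μ.prod b.μ) hk hf (ε := ε / 4) (by positivity)
  have hm : Measurable fun p : a.X × b.X => φ (g p.1, h p.2) :=
    Measurable.of_discrete.comp (by fun_prop : Measurable fun p : a.X × b.X => (g p.1, h p.2))
  refine ⟨N, fun p : a.X × b.X => φ (g p.1, h p.2), ⟨g, h, φ, hg, hh, fun _ => rfl⟩, ?_⟩
  have hdist : dist ((a.prod b).M S k f) ((a.prod b).M S k fun p : a.X × b.X => φ (g p.1, h p.2)) ≤
      2 * (a.μ.prod b.μ).real {p : a.X × b.X | f p ≠ φ (g p.1, h p.2)} :=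
    (a.prod b).dist_M_le S hf hm
  have htri := dist_triangle v ((a.prod b).M S k f)
    ((a.prod b).M S k fun p : a.X × b.X => φ (g p.1, h p.2))
  linarith

/-- The set defining `NStep` is nonempty. -/
lemma exists_stepNet (a b : PMP Γ) (S : Finset Γ) {k : ℕ} (hk : 0 < k) {ε : ℝ} (hε : 0 < ε) :
    ∃ N : ℕ, 0 < N ∧ StepNet a b S k N ε := by
  have : Nonempty (Fin k) := ⟨⟨0, hk⟩⟩
  choose! n f hf hd using fun v (hv : v ∈ (a.prod b).C S k) =>
    exists_isStep_dist_lt hk (half_pos hε) hv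
  obtain ⟨t, ht, hcov⟩ := ((a.prod b).isCompact_C S k).elim_nhds_subcover
    (fun v => Metric.ball v (ε / 2)) fun v _ => Metric.ball_mem_nhds v (half_pos hε)
  refine ⟨t.sup n + 1, Nat.succ_pos _, fun v hv => ?_⟩
  obtain ⟨w, hw, hvw⟩ := Set.mem_iUnion₂.1 (hcov hv)
  refine ⟨f w, (hf w (ht w hw)).mono ((Finset.le_sup hw).trans (Nat.le_succ _)), ?_⟩
  linarith [dist_triangle v w ((a.prod b).M S k (f w)), hd w (ht w hw), Metric.mem_ball.1 hvw]

lemma stepNet_of_NStep_le {a b : PMP Γ} {S : Finset Γ} {k N : ℕ} (hk : 0 < k) {ε : ℝ} (hε : 0 < ε)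
    (h : NStep a b S k ε ≤ N) : StepNet a b S k N ε :=
  (Nat.sInf_mem (exists_stepNet a b S hk hε)).2.mono h

lemma StepNet.exists_dist_le {a b a' b' : PMP Γ} {S : Finset Γ} {k N : ℕ} {ε δ : ℝ} (hN : 0 < N)
    (hnet : StepNet a b S k N ε)
    (ha : Metric.hausdorffDist (a.C S N) (a'.C S N) < δ)
    (hb : Metric.hausdorffDist (b.C S N) (b'.C S N) < δ)
    {v : ↥S × Fin k × Fin k → ℝ} (hv : v ∈ (a.prod b).C S k) :
    ∃ v' ∈ (a'.prod b').C S k, dist v v' ≤ ε + N ^ 4 * (2 * (2 * δ)) := by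
  have hδ : 0 < δ := Metric.hausdorffDist_nonneg.trans_lt ha
  obtain ⟨f, ⟨g, h, φ, hg, hh, hφ⟩, hd⟩ := hnet v hv
  have approx {a a' : PMP Γ} (ha : Metric.hausdorffDist (a.C S N) (a'.C S N) < δ)
      {g : a.X → Fin N} (hg : Measurable g) :
      ∃ g' : a'.X → Fin N, Measurable g' ∧ dist (a.M S N g) (a'.M S N g') ≤ 2 * δ := by
    obtain ⟨w, hw, hgw⟩ := Metric.exists_dist_lt_of_hausdorffDist_lt (a.M_mem_C S hg) ha
      (a.hausdorffEDist_C_ne_top a' S hN)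
    obtain ⟨g', hg', hwg⟩ := PMP.exists_measurable_dist_lt hw hδ
    refine ⟨g', hg', ?_⟩
    linarith [dist_triangle (a.M S N g) w (a'.M S N g')]
  obtain ⟨g', hg', hgg⟩ := approx ha hg
  obtain ⟨h', hh', hhh⟩ := approx hb hh
  have hm : Measurable fun p : a'.X × b'.X => φ (g' p.1, h' p.2) :=
    Measurable.of_discrete.comp (by fun_prop : Measurable fun p : a'.X × b'.X => (g' p.1, h' p.2))
  refine ⟨_, (a'.prod b').M_mem_C S hm, ?_⟩
  have hfe : f = fun p : a.X × b.X => φ (g p.1, h p.2) := funext hφ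
  rw [hfe] at hd
  have := PMP.dist_M_prod_step_le hg hh hg' hh' φ hgg hhh
  exact (dist_triangle _ _ _).trans (add_le_add hd.le this)

/-- (From the proof of Theorem 4.2, implication (2) ⇒ (1).)  If `α_i → α` and `β_i → β` in
the topology of the space of weak equivalence classes, and the quantities
`N_{S,k}(α_i,β_i,ε)` are bounded uniformly in `i`, then `α_i × β_i → α × β`. -/
theorem tendsto_prod_of_NStep_bounded {Γ : Type} [Group Γ] [Countable Γ] [Infinite Γ]
    (A B : ℕ → PMP Γ) (a b : PMP Γ)
    (hA : ∀ (S' : Finset Γ) (k' : ℕ), 0 < k' →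
      Tendsto (fun i => Metric.hausdorffDist ((A i).C S' k') (a.C S' k')) atTop (𝓝 0))
    (hB : ∀ (S' : Finset Γ) (k' : ℕ), 0 < k' →
      Tendsto (fun i => Metric.hausdorffDist ((B i).C S' k') (b.C S' k')) atTop (𝓝 0))
    (hbdd : ∀ (S : Finset Γ) (k : ℕ), 0 < k → ∀ ε : ℝ, 0 < ε →
      ∃ N : ℕ, 0 < N ∧ ∀ i : ℕ, NStep (A i) (B i) S k ε ≤ N) :
    ∀ (S : Finset Γ) (k : ℕ), 0 < k →
      Tendsto (fun i =>
        Metric.hausdorffDist (((A i).prod (B i)).C S k) ((a.prod b).C S k))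
        atTop (𝓝 0) := by
  intro S k hk
  rw [Metric.tendsto_nhds]
  intro ε hε
  obtain ⟨N₁, hN₁, hle⟩ := hbdd S k hk (ε / 4) (by positivity)
  obtain ⟨N₂, hN₂, hnet⟩ := exists_stepNet a b S hk (ε := ε / 4) (by positivity)
  have hδ (N : ℕ) (hN : 0 < N) :
      ∀ᶠ i in atTop, Metric.hausdorffDist ((A i).C S N) (a.C S N) < ε / (16 * N ^ 4) ∧
        Metric.hausdorffDist ((B i).C S N) (b.C S N) < ε / (16 * N ^ 4) :=
    ((hA S N hN).eventually_lt_const (by positivity)).and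
      ((hB S N hN).eventually_lt_const (by positivity))
  have hsum (N : ℕ) (hN : 0 < N) :
      ε / 4 + (N : ℝ) ^ 4 * (2 * (2 * (ε / (16 * N ^ 4)))) = ε / 2 := by
    have : (N : ℝ) ≠ 0 := by positivity
    field_simp
    norm_num
  filter_upwards [hδ N₁ hN₁, hδ N₂ hN₂] with i h₁ h₂
  rw [Real.dist_0_eq_abs, abs_of_nonneg Metric.hausdorffDist_nonneg]
  refine (Metric.hausdorffDist_le_of_mem_dist (half_pos hε).le (fun v hv => ?_)
    fun v hv => ?_).trans_lt (half_lt_self hε)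
  · rw [← hsum N₁ hN₁]
    exact (stepNet_of_NStep_le hk (by positivity) (hle i)).exists_dist_le hN₁ h₁.1 h₁.2 hv
  · rw [← hsum N₂ hN₂]
    exact hnet.exists_dist_le hN₂ (Metric.hausdorffDist_comm.trans_lt h₂.1)
      (Metric.hausdorffDist_comm.trans_lt h₂.2) hv
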